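/- Let ε, μ : ℝ³ → ℝ be C² up to the boundary of Π with ε > 0 and μ > 0 on the closure of Π. Let u, w : ℝ³ → ℂ³ be C² up to the boundary, with u of compact axial support, div(εu) = 0 on Π, and u = ⟨u, ν⟩·ν, w = ⟨w, ν⟩·ν on ∂Π (tangential components vanish). Then ∫_Π μ⁻¹·⟨curl u, curl w⟩ dx = ∫_Π Σⱼ ⟨∂ⱼ(ε^{1/2}u), ∂ⱼ(ε^{−1/2}μ⁻¹w)⟩ dx − ∫_Π ⟨curl u, ε·[∇((εμ)⁻¹), w]⟩ dx + ∫_Π μ⁻¹·⟨W(ε)u, w⟩ dx + ∫_{∂Π} (μ⁻¹R⁻¹ + (2εμ)⁻¹·∂_νε)·⟨u, w⟩ dS, where ∂_νε = ⟨∇ε, ν⟩. -/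

import Mathlib

noncomputable section

open MeasureTheory Real Complex

/-- Points of `ℝ³`. -/
abbrev V3 := Fin 3 → ℝ
/-- Vectors of `ℂ³`. -/
abbrev C3 := Fin 3 → ℂ

/-- Partial derivative `∂ⱼ` of a complex scalar function on `ℝ³`. -/
def pd (j : Fin 3) (f : V3 → ℂ) (x : V3) : ℂ := fderiv ℝ f x (Pi.single j 1)

/-- Partial derivative `∂ⱼ` of a real scalar function on `ℝ³`. -/
def pdR (j : Fin 3) (f : V3 → ℝ) (x : V3) : ℝ := fderiv ℝ f x (Pi.single j 1)

/-- Partial derivative `∂ⱼ` of a vector field, taken componentwise. -/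
def pdV (j : Fin 3) (a : V3 → C3) (x : V3) : C3 := fun i => pd j (fun y => a y i) x

/-- curl a = (∂₂a₃ − ∂₃a₂, ∂₃a₁ − ∂₁a₃, ∂₁a₂ − ∂₂a₁)  (indices 0,1,2). -/
def vcurl (a : V3 → C3) (x : V3) : C3 :=
  ![pd 1 (fun y => a y 2) x - pd 2 (fun y => a y 1) x,
    pd 2 (fun y => a y 0) x - pd 0 (fun y => a y 2) x,
    pd 0 (fun y => a y 1) x - pd 1 (fun y => a y 0) x]

/-- div a = ∂₁a₁ + ∂₂a₂ + ∂₃a₃. -/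
def vdiv (a : V3 → C3) (x : V3) : ℂ := ∑ j, pd j (fun y => a y j) x

/-- The bilinear (unconjugated) cross product on ℂ³. -/
def cross (a b : C3) : C3 :=
  ![a 1 * b 2 - a 2 * b 1, a 2 * b 0 - a 0 * b 2, a 0 * b 1 - a 1 * b 0]

/-- The Hermitian inner product ⟨a, b⟩ = Σⱼ aⱼ · conj(bⱼ). -/
def hinner (a b : C3) : ℂ := ∑ j, a j * (starRingEnd ℂ) (b j)

/-- The gradient of a real function, viewed as a complex vector. -/
def gradC (g : V3 → ℝ) (x : V3) : C3 := fun j => (pdR j g x : ℂ)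

/-- The Laplacian Δg = ∂₁²g + ∂₂²g + ∂₃²g of a real function. -/
def lapR (g : V3 → ℝ) (x : V3) : ℝ := ∑ j, pdR j (fun y => pdR j g y) x

/-- The solid infinite circular cylinder Π of radius `R`. -/
def Cyl (R : ℝ) : Set V3 := {x | x 0 ^ 2 + x 1 ^ 2 < R ^ 2}

/-- The boundary ∂Π of the cylinder. -/
def bCyl (R : ℝ) : Set V3 := {x | x 0 ^ 2 + x 1 ^ 2 = R ^ 2}

/-- The outward unit normal of the cylinder at a boundary point. -/
def nuR (R : ℝ) (x : V3) : V3 := ![x 0 / R, x 1 / R, 0]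

/-- The outward unit normal, viewed as a complex vector. -/
def nuC (R : ℝ) (x : V3) : C3 := fun j => (nuR R x j : ℂ)

/-- The normal component ⟨z, ν⟩ of z ∈ ℂ³ at a boundary point of the cylinder. -/
def ncomp (R : ℝ) (x : V3) (z : C3) : ℂ := ∑ k, z k * (nuR R x k : ℂ)

/-- The normal derivative ∂_ν g = ⟨∇g, ν⟩ of a real function at a boundary point. -/
def dnu (R : ℝ) (g : V3 → ℝ) (x : V3) : ℝ := ∑ k, pdR k g x * nuR R x k

/-- The surface integral ∫_{∂Π} F dS = ∫_ℝ ∫₀^{2π} F(R cos θ, R sin θ, t)·R dθ dt. -/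
def surfInt (R : ℝ) (F : V3 → ℂ) : ℂ :=
  ∫ t : ℝ, ∫ θ in (0:ℝ)..(2 * π), F ![R * Real.cos θ, R * Real.sin θ, t] * (R : ℂ)

/-- `f` is `C^k` up to the boundary of the open set `S`: it is `k` times continuously
differentiable on an open neighborhood of the closure of `S`. -/
def UpTo {E : Type*} [NormedAddCommGroup E] [NormedSpace ℝ E]
    (k : ℕ) (S : Set V3) (f : V3 → E) : Prop :=
  ∃ U : Set V3, IsOpen U ∧ closure S ⊆ U ∧ ContDiffOn ℝ k f U

/-- `f` has compact axial support: it vanishes whenever `|x₃| ≥ T` for some `T > 0`. -/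
def AxialSupp {E : Type*} [Zero E] (f : V3 → E) : Prop :=
  ∃ T > 0, ∀ x : V3, T ≤ |x 2| → f x = 0

/-- The matrix W₀(μ)ⱼₖ = μ⁻¹(Δμ)δⱼₖ + μ⁻²(∂ⱼμ)(∂ₖμ) − μ⁻¹∂ⱼ∂ₖμ. -/
def W0 (μ : V3 → ℝ) (x : V3) (j k : Fin 3) : ℝ :=
  (μ x)⁻¹ * lapR μ x * (if j = k then 1 else 0)
    + ((μ x) ^ 2)⁻¹ * pdR j μ x * pdR k μ x
    - (μ x)⁻¹ * pdR j (fun y => pdR k μ y) x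

/-- The matrix W(μ)ⱼₖ = ((2μ)⁻¹Δμ − (4μ²)⁻¹|∇μ|²)δⱼₖ + μ⁻²(∂ⱼμ)(∂ₖμ) − μ⁻¹∂ⱼ∂ₖμ. -/
def Wm (μ : V3 → ℝ) (x : V3) (j k : Fin 3) : ℝ :=
  ((2 * μ x)⁻¹ * lapR μ x - (4 * (μ x) ^ 2)⁻¹ * (∑ i, (pdR i μ x) ^ 2))
      * (if j = k then 1 else 0)
    + ((μ x) ^ 2)⁻¹ * pdR j μ x * pdR k μ x
    - (μ x)⁻¹ * pdR j (fun y => pdR k μ y) x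

theorem convexCombination_mem_Cyl {R : ℝ} {x : V3} (hx : x 0 ^ 2 + x 1 ^ 2 ≤ R ^ 2) (hR : 0 < R)
    {s : ℝ} (hs : s ∈ Set.Ico (0 : ℝ) 1) : ![s * x 0, s * x 1, x 2] ∈ Cyl R := by
  obtain ⟨h0, h1⟩ := hs
  simp only [Cyl, Set.mem_ofPred_eq, Matrix.cons_val_zero, Matrix.cons_val_one]
  have hR2 : 0 < R ^ 2 := by positivity
  have hs2 : s ^ 2 < 1 := by nlinarith
  nlinarith [mul_le_mul_of_nonneg_left hx (sq_nonneg s)]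

theorem mem_closure_Cyl {R : ℝ} {x : V3} (hx : x 0 ^ 2 + x 1 ^ 2 ≤ R ^ 2) (hR : 0 < R) :
    x ∈ closure (Cyl R) := by
  have hc : Continuous (fun s : ℝ => (![s * x 0, s * x 1, x 2] : V3)) := by
    refine continuous_pi fun i => ?_
    fin_cases i <;> simp <;> fun_prop
  have h1 : x = (fun s : ℝ => (![s * x 0, s * x 1, x 2] : V3)) 1 := by
    ext i; fin_cases i <;> simp
  have hcl : (1 : ℝ) ∈ closure (Set.Ico (0 : ℝ) 1) := by
    rw [closure_Ico (by norm_num)]; simp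
  have h2 := map_mem_closure hc hcl (t := Cyl R) fun s hs => convexCombination_mem_Cyl hx hR hs
  exact h1 ▸ h2

theorem isOpen_Cyl (R : ℝ) : IsOpen (Cyl R) := by
  unfold Cyl
  exact isOpen_lt (by fun_prop) (by fun_prop)

theorem isCompact_truncatedCyl (R T : ℝ) :
    IsCompact {x : V3 | x 0 ^ 2 + x 1 ^ 2 ≤ R ^ 2 ∧ |x 2| ≤ T} := by
  refine Metric.isCompact_of_isClosed_isBounded ?_ ?_
  · have h1 : IsClosed {x : V3 | x 0 ^ 2 + x 1 ^ 2 ≤ R ^ 2} :=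
      isClosed_le (by fun_prop) (by fun_prop)
    have h2 : IsClosed {x : V3 | |x 2| ≤ T} := isClosed_le (by fun_prop) (by fun_prop)
    exact h1.inter h2
  · refine (Metric.isBounded_iff_subset_closedBall (0 : V3)).2 ⟨max |R| |T|, fun x hx => ?_⟩
    obtain ⟨h, h2⟩ := hx
    rw [mem_closedBall_zero_iff, pi_norm_le_iff_of_nonneg (by positivity)]
    have a0 : |x 0| ≤ |R| := sq_le_sq.1 (by nlinarith [sq_nonneg (x 1)])
    have a1 : |x 1| ≤ |R| := sq_le_sq.1 (by nlinarith [sq_nonneg (x 0)])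
    intro i
    fin_cases i
    · exact le_max_of_le_left a0
    · exact le_max_of_le_left a1
    · exact le_max_of_le_right (h2.trans (le_abs_self T))

theorem integrableOn_Cyl {R T : ℝ} (hR : 0 < R) {f : V3 → ℂ}
    (hf : ContinuousOn f (closure (Cyl R))) (h0 : ∀ x, T ≤ |x 2| → f x = 0) :
    IntegrableOn f (Cyl R) := by
  have hK : IntegrableOn f {x : V3 | x 0 ^ 2 + x 1 ^ 2 ≤ R ^ 2 ∧ |x 2| ≤ T} :=
    (hf.mono fun x hx => mem_closure_Cyl hx.1 hR).integrableOn_compact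
      (isCompact_truncatedCyl R T)
  refine hK.of_forall_sdiff_eq_zero (isOpen_Cyl R).measurableSet fun x hx => h0 x ?_
  by_contra h
  exact hx.2 ⟨le_of_lt hx.1, (not_le.1 h).le⟩

/-- The coordinates `((x₀, x₁), x₂)` on `ℝ³`. -/
def prodEquiv : V3 ≃ᵐ ℝ × (ℝ × ℝ) :=
  (MeasurableEquiv.piFinSuccAbove (fun _ : Fin 3 => ℝ) 2).trans
    ((MeasurableEquiv.refl ℝ).prodCongr (MeasurableEquiv.finTwoArrow))

theorem volume_preserving_prodEquiv : MeasurePreserving prodEquiv :=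
  (volume_preserving_piFinSuccAbove (fun _ : Fin 3 => ℝ) 2).trans
    ((MeasurePreserving.id volume).prod (volume_preserving_finTwoArrow ℝ))

theorem prodEquiv_symm_apply (p : ℝ × (ℝ × ℝ)) :
    prodEquiv.symm p = ![p.2.1, p.2.2, p.1] := by
  rw [MeasurableEquiv.symm_apply_eq]
  ext <;> simp [prodEquiv, MeasurableEquiv.piFinSuccAbove, Fin.insertNthEquiv] <;> rfl

theorem prodEquiv_symm_preimage_Cyl (R : ℝ) :
    prodEquiv.symm ⁻¹' Cyl R = Set.univ ×ˢ {q : ℝ × ℝ | q.1 ^ 2 + q.2 ^ 2 < R ^ 2} := by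
  ext p
  simp [prodEquiv_symm_apply, Cyl]

theorem setIntegral_Cyl_eq_prod (R : ℝ) (g : V3 → ℂ) :
    ∫ x in Cyl R, g x = ∫ p in Set.univ ×ˢ {q : ℝ × ℝ | q.1 ^ 2 + q.2 ^ 2 < R ^ 2},
      g ![p.2.1, p.2.2, p.1] := by
  rw [← prodEquiv_symm_preimage_Cyl,
    ← volume_preserving_prodEquiv.symm.setIntegral_preimage_emb
      prodEquiv.symm.measurableEmbedding]
  simp [prodEquiv_symm_apply]

theorem integrableOn_prod_of_integrableOn_Cyl {R : ℝ} {g : V3 → ℂ} (hg : IntegrableOn g (Cyl R)) :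
    IntegrableOn (fun p : ℝ × (ℝ × ℝ) => g ![p.2.1, p.2.2, p.1])
      (Set.univ ×ˢ {q : ℝ × ℝ | q.1 ^ 2 + q.2 ^ 2 < R ^ 2}) (volume.prod volume) := by
  rw [← prodEquiv_symm_preimage_Cyl]
  have := (volume_preserving_prodEquiv.symm.integrableOn_comp_preimage
      prodEquiv.symm.measurableEmbedding (f := g) (s := Cyl R)).2 hg
  refine this.congr (ae_of_all _ fun p => ?_)
  simp [prodEquiv_symm_apply]

theorem fderiv_apply_eq_sum_pd (f : V3 → ℂ) (x v : V3) :
    fderiv ℝ f x v = ∑ j, (v j : ℂ) * pd j f x := by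
  conv_lhs => rw [← Finset.univ_sum_single v]
  rw [map_sum]
  refine Finset.sum_congr rfl fun j _ => ?_
  have h : (Pi.single j (v j) : V3) = v j • Pi.single j (1 : ℝ) := by
    rw [← Pi.single_smul, smul_eq_mul, mul_one]
  rw [h, map_smul, pd, Complex.real_smul]

theorem hasDerivAt_comp_curve {f : V3 → ℂ} {γ : ℝ → V3} {v : V3} {s : ℝ}
    (hf : DifferentiableAt ℝ f (γ s)) (hγ : HasDerivAt γ v s) :
    HasDerivAt (fun r => f (γ r)) (∑ j, (v j : ℂ) * pd j f (γ s)) s := by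
  rw [← fderiv_apply_eq_sum_pd]
  exact hf.hasFDerivAt.comp_hasDerivAt s hγ

theorem continuousOn_pd {U : Set V3} (hU : IsOpen U) {f : V3 → ℂ} (hf : ContDiffOn ℝ 1 f U)
    (j : Fin 3) : ContinuousOn (pd j f) U :=
  (hf.continuousOn_fderiv_of_isOpen hU le_rfl).clm_apply continuousOn_const

theorem contDiffOn_pd {U : Set V3} (hU : IsOpen U) {f : V3 → ℂ} (hf : ContDiffOn ℝ 2 f U)
    (j : Fin 3) : ContDiffOn ℝ 1 (pd j f) U :=
  (hf.fderiv_of_isOpen hU (by norm_num)).clm_apply contDiffOn_const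

theorem pd_eq_zero_of_axialSupp {f : V3 → ℂ} {T : ℝ} (hf : ∀ x : V3, T ≤ |x 2| → f x = 0)
    (j : Fin 3) {x : V3} (hx : T < |x 2|) : pd j f x = 0 := by
  have hopen : IsOpen {y : V3 | T < |y 2|} := isOpen_lt (by fun_prop) (by fun_prop)
  have : f =ᶠ[nhds x] fun _ => 0 := by
    filter_upwards [hopen.mem_nhds hx] with y hy
    exact hf y (le_of_lt hy)
  rw [pd, this.fderiv_eq]
  simp

/-- Cylindrical coordinates at height `t`. -/
def polarPoint (t : ℝ) (p : ℝ × ℝ) : V3 := ![p.1 * Real.cos p.2, p.1 * Real.sin p.2, t]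

theorem contDiff_polarPoint (t : ℝ) {n : WithTop ℕ∞} : ContDiff ℝ n (polarPoint t) := by
  refine contDiff_pi.2 fun i => ?_
  fin_cases i
  · exact contDiff_fst.mul (Real.contDiff_cos.comp contDiff_snd)
  · exact contDiff_fst.mul (Real.contDiff_sin.comp contDiff_snd)
  · exact contDiff_const

theorem polarPoint_mem_closure {R t : ℝ} (hR : 0 < R) {p : ℝ × ℝ}
    (hp : p.1 ∈ Set.Icc 0 R) : polarPoint t p ∈ closure (Cyl R) := by
  refine mem_closure_Cyl ?_ hR
  obtain ⟨h0, h1⟩ := hp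
  simp only [polarPoint, Matrix.cons_val_zero, Matrix.cons_val_one]
  have h : (p.1 * Real.cos p.2) ^ 2 + (p.1 * Real.sin p.2) ^ 2 = p.1 ^ 2 := by
    linear_combination p.1 ^ 2 * Real.sin_sq_add_cos_sq p.2
  rw [h]
  gcongr

theorem hasDerivAt_polarPoint_radius (t r θ : ℝ) :
    HasDerivAt (fun s => polarPoint t (s, θ)) ![Real.cos θ, Real.sin θ, 0] r := by
  refine hasDerivAt_pi.2 fun i => ?_
  fin_cases i
  · simpa [polarPoint] using (hasDerivAt_id r).mul_const (Real.cos θ)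
  · simpa [polarPoint] using (hasDerivAt_id r).mul_const (Real.sin θ)
  · simpa [polarPoint] using hasDerivAt_const r t

theorem hasDerivAt_polarPoint_angle (t r θ : ℝ) :
    HasDerivAt (fun s => polarPoint t (r, s)) ![-(r * Real.sin θ), r * Real.cos θ, 0] θ := by
  refine hasDerivAt_pi.2 fun i => ?_
  fin_cases i
  · simpa [polarPoint] using (Real.hasDerivAt_cos θ).const_mul r
  · simpa [polarPoint] using (Real.hasDerivAt_sin θ).const_mul r
  · simpa [polarPoint] using hasDerivAt_const θ t

theorem setIntegral_disk_eq_polar {R : ℝ} (hR : 0 < R) (h : ℝ × ℝ → ℂ) :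
    ∫ q in {q : ℝ × ℝ | q.1 ^ 2 + q.2 ^ 2 < R ^ 2}, h q
      = ∫ p in Set.Icc ((0 : ℝ), -π) (R, π),
        (p.1 : ℂ) * h (p.1 * Real.cos p.2, p.1 * Real.sin p.2) := by
  have hD : MeasurableSet {q : ℝ × ℝ | q.1 ^ 2 + q.2 ^ 2 < R ^ 2} :=
    (isOpen_lt (by fun_prop) (by fun_prop)).measurableSet
  have hS : MeasurableSet {p : ℝ × ℝ | p.1 < R} :=
    (isOpen_lt (by fun_prop) (by fun_prop)).measurableSet
  rw [← integral_indicator hD, ← integral_comp_polarCoord_symm]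
  have hT : polarCoord.target ∩ {p : ℝ × ℝ | p.1 < R} = Set.Ioo 0 R ×ˢ Set.Ioo (-π) π := by
    ext p
    simp [polarCoord_target]
    tauto
  calc
    _ = ∫ p in polarCoord.target, {p : ℝ × ℝ | p.1 < R}.indicator
          (fun p => (p.1 : ℂ) * h (p.1 * Real.cos p.2, p.1 * Real.sin p.2)) p := by
        refine setIntegral_congr_fun polarCoord.open_target.measurableSet fun p hp => ?_
        have hp0 : 0 < p.1 := hp.1
        have hn : (p.1 * Real.cos p.2) ^ 2 + (p.1 * Real.sin p.2) ^ 2 = p.1 ^ 2 := by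
          linear_combination p.1 ^ 2 * Real.sin_sq_add_cos_sq p.2
        by_cases hpR : p.1 < R
        · have h2 : p.1 ^ 2 < R ^ 2 := by gcongr
          simp [Set.indicator, polarCoord_symm_apply, hn, hpR, h2]
        · have h2 : ¬ p.1 ^ 2 < R ^ 2 := by
            rw [not_lt] at hpR ⊢
            gcongr
          simp [Set.indicator, polarCoord_symm_apply, hn, hpR, h2]
    _ = _ := by
        rw [setIntegral_indicator hS, hT, ← Set.Icc_prod_Icc]
        exact setIntegral_congr_set (Measure.set_prod_ae_eq Ioo_ae_eq_Icc Ioo_ae_eq_Icc)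

theorem integral_disk_divergence {R : ℝ} (hR : 0 < R) {U : Set V3} (hU : IsOpen U)
    (hcl : closure (Cyl R) ⊆ U) {f g : V3 → ℂ} (hf : ContDiffOn ℝ 1 f U)
    (hg : ContDiffOn ℝ 1 g U) (t : ℝ) :
    ∫ q in {q : ℝ × ℝ | q.1 ^ 2 + q.2 ^ 2 < R ^ 2},
        (pd 0 f ![q.1, q.2, t] + pd 1 g ![q.1, q.2, t])
      = ∫ θ in (0:ℝ)..(2 * π), (Real.cos θ * f (polarPoint t (R, θ))
          + Real.sin θ * g (polarPoint t (R, θ))) * R := by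
  rw [setIntegral_disk_eq_polar hR]
  set P : ℝ × ℝ → ℂ := fun p => p.1 * (Real.cos p.2 * f (polarPoint t p)
    + Real.sin p.2 * g (polarPoint t p)) with hP
  set Q : ℝ × ℝ → ℂ := fun p => -Real.sin p.2 * f (polarPoint t p)
    + Real.cos p.2 * g (polarPoint t p) with hQ
  set V : Set (ℝ × ℝ) := polarPoint t ⁻¹' U with hV
  have hVo : IsOpen V := hU.preimage (contDiff_polarPoint t (n := 0)).continuous
  have hmaps : Set.MapsTo (polarPoint t) V U := fun p hp => hp
  have hsub : Set.Icc ((0 : ℝ), -π) (R, π) ⊆ V := fun p hp =>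
    hcl (polarPoint_mem_closure hR ⟨hp.1.1, hp.2.1⟩)
  have hfV : ContDiffOn ℝ 1 (fun p => f (polarPoint t p)) V :=
    hf.comp (contDiff_polarPoint t).contDiffOn hmaps
  have hgV : ContDiffOn ℝ 1 (fun p => g (polarPoint t p)) V :=
    hg.comp (contDiff_polarPoint t).contDiffOn hmaps
  have hre : ContDiff ℝ 1 (fun p : ℝ × ℝ => (p.1 : ℂ)) :=
    Complex.ofRealCLM.contDiff.comp contDiff_fst
  have hcos : ContDiff ℝ 1 (fun p : ℝ × ℝ => (Real.cos p.2 : ℂ)) :=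
    Complex.ofRealCLM.contDiff.comp (Real.contDiff_cos.comp contDiff_snd)
  have hsin : ContDiff ℝ 1 (fun p : ℝ × ℝ => (Real.sin p.2 : ℂ)) :=
    Complex.ofRealCLM.contDiff.comp (Real.contDiff_sin.comp contDiff_snd)
  have hPV : ContDiffOn ℝ 1 P V :=
    hre.contDiffOn.mul ((hcos.contDiffOn.mul hfV).add (hsin.contDiffOn.mul hgV))
  have hQV : ContDiffOn ℝ 1 Q V :=
    (hsin.neg.contDiffOn.mul hfV).add (hcos.contDiffOn.mul hgV)
  have hd {F : V3 → ℂ} (hF : ContDiffOn ℝ 1 F U) {p : ℝ × ℝ} (hp : p ∈ V) :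
      DifferentiableAt ℝ F (polarPoint t p) :=
    (hF.differentiableOn one_ne_zero).differentiableAt (hU.mem_nhds hp)
  have hdV {F : ℝ × ℝ → ℂ} (hF : ContDiffOn ℝ 1 F V) {p : ℝ × ℝ} (hp : p ∈ V) :
      DifferentiableAt ℝ F p :=
    (hF.differentiableOn one_ne_zero).differentiableAt (hVo.mem_nhds hp)
  have hdiv : ∀ p ∈ V, fderiv ℝ P p (1, 0) + fderiv ℝ Q p (0, 1)
      = p.1 * (pd 0 f (polarPoint t p) + pd 1 g (polarPoint t p)) := by
    rintro ⟨r, θ⟩ hp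
    have e1 : HasDerivAt (fun s : ℝ => (s, θ)) (1, 0) r :=
      (hasDerivAt_id r).prodMk (hasDerivAt_const r θ)
    have e2 : HasDerivAt (fun s : ℝ => (r, s)) (0, 1) θ :=
      (hasDerivAt_const θ r).prodMk (hasDerivAt_id θ)
    have hP1 := (hdV hPV hp).hasFDerivAt.comp_hasDerivAt r e1
    have hQ1 := (hdV hQV hp).hasFDerivAt.comp_hasDerivAt θ e2
    have hf1 := hasDerivAt_comp_curve (hd hf hp) (hasDerivAt_polarPoint_radius t r θ)
    have hg1 := hasDerivAt_comp_curve (hd hg hp) (hasDerivAt_polarPoint_radius t r θ)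
    have hf2 := hasDerivAt_comp_curve (hd hf hp) (hasDerivAt_polarPoint_angle t r θ)
    have hg2 := hasDerivAt_comp_curve (hd hg hp) (hasDerivAt_polarPoint_angle t r θ)
    have hid : HasDerivAt (fun s : ℝ => (s : ℂ)) 1 r := Complex.ofRealCLM.hasDerivAt
    have hc : HasDerivAt (fun s : ℝ => (Real.cos s : ℂ)) ((-Real.sin θ : ℝ) : ℂ) θ :=
      (Real.hasDerivAt_cos θ).ofReal_comp
    have hs : HasDerivAt (fun s : ℝ => (Real.sin s : ℂ)) ((Real.cos θ : ℝ) : ℂ) θ :=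
      (Real.hasDerivAt_sin θ).ofReal_comp
    have hP2 := hid.mul ((hf1.const_mul (Real.cos θ : ℂ)).add (hg1.const_mul (Real.sin θ : ℂ)))
    have hQ2 := (hs.neg.mul hf2).add (hc.mul hg2)
    rw [hP1.unique hP2, hQ1.unique hQ2]
    have hcs : (Real.sin θ : ℂ) ^ 2 + (Real.cos θ : ℂ) ^ 2 = 1 := by
      exact_mod_cast Real.sin_sq_add_cos_sq θ
    simp only [Fin.sum_univ_three, Matrix.cons_val_zero, Matrix.cons_val_one, Matrix.cons_val,
      Pi.add_apply, Pi.neg_apply, Complex.ofReal_neg, Complex.ofReal_mul, Complex.ofReal_zero]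
    linear_combination (r : ℂ) * (pd 0 f (polarPoint t (r, θ)) + pd 1 g (polarPoint t (r, θ))) * hcs
  have hπ : -π ≤ π := by linarith [Real.pi_pos]
  have hcont : ContinuousOn
      (fun p : ℝ × ℝ => (p.1 : ℂ) * (pd 0 f (polarPoint t p) + pd 1 g (polarPoint t p))) V :=
    hre.continuous.continuousOn.mul
      (((continuousOn_pd hU hf 0).comp (contDiff_polarPoint t (n := 0)).continuous.continuousOn
        hmaps).add ((continuousOn_pd hU hg 1).comp
        (contDiff_polarPoint t (n := 0)).continuous.continuousOn hmaps))
  have hIoo : Set.Ioo (0 : ℝ) R ×ˢ Set.Ioo (-π) π ⊆ V := fun p hp =>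
    hsub ⟨⟨hp.1.1.le, hp.2.1.le⟩, ⟨hp.1.2.le, hp.2.2.le⟩⟩
  have key := integral_divergence_prod_Icc_of_hasFDerivAt_of_le P Q (fderiv ℝ P) (fderiv ℝ Q)
    (0, -π) (R, π) ⟨hR.le, hπ⟩ (hPV.continuousOn.mono hsub) (hQV.continuousOn.mono hsub)
    (fun p hp => (hdV hPV (hIoo hp)).hasFDerivAt) (fun p hp => (hdV hQV (hIoo hp)).hasFDerivAt)
    (((hcont.congr hdiv).mono hsub).integrableOn_compact isCompact_Icc)
  rw [setIntegral_congr_fun measurableSet_Icc (fun p hp => hdiv p (hsub hp))] at key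
  have hQper : ∀ r, Q (r, π) = Q (r, -π) := fun r => by simp [hQ, polarPoint]
  have hP0 : ∀ θ, P (0, θ) = 0 := fun θ => by simp [hP]
  simp only [hQper, sub_self, zero_add, hP0, intervalIntegral.integral_zero, sub_zero] at key
  refine (Eq.trans ?_ key).trans ?_
  · rfl
  · have hper : Function.Periodic (fun θ => P (R, θ)) (2 * π) := fun θ => by
      simp only [hP, polarPoint, Real.cos_add_two_pi, Real.sin_add_two_pi]
    have := hper.intervalIntegral_add_eq (-π) 0
    rw [show -π + 2 * π = π by ring, zero_add] at this
    rw [this]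
    refine intervalIntegral.integral_congr fun θ _ => ?_
    simp only [hP]
    ring

theorem setIntegral_Cyl_horizontal_divergence {R : ℝ} (hR : 0 < R) {U : Set V3} (hU : IsOpen U)
    (hcl : closure (Cyl R) ⊆ U) {f g : V3 → ℂ} (hf : ContDiffOn ℝ 1 f U)
    (hg : ContDiffOn ℝ 1 g U)
    (hi : IntegrableOn (fun x => pd 0 f x + pd 1 g x) (Cyl R)) :
    ∫ x in Cyl R, (pd 0 f x + pd 1 g x)
      = ∫ t : ℝ, ∫ θ in (0:ℝ)..(2 * π), (Real.cos θ * f (polarPoint t (R, θ))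
          + Real.sin θ * g (polarPoint t (R, θ))) * R := by
  have hi' := integrableOn_prod_of_integrableOn_Cyl hi
  rw [setIntegral_Cyl_eq_prod, Measure.volume_eq_prod, setIntegral_prod _ hi', setIntegral_univ]
  exact integral_congr_ae (ae_of_all _ fun t => integral_disk_divergence hR hU hcl hf hg t)

theorem setIntegral_Cyl_axial_derivative {R T : ℝ} {U : Set V3} (hU : IsOpen U)
    (hcl : closure (Cyl R) ⊆ U) {f : V3 → ℂ} (hf : ContDiffOn ℝ 1 f U)
    (hT : ∀ x : V3, T ≤ |x 2| → f x = 0)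
    (hi : IntegrableOn (pd 2 f) (Cyl R)) :
    ∫ x in Cyl R, pd 2 f x = 0 := by
  have hi' := integrableOn_prod_of_integrableOn_Cyl hi
  have hD : MeasurableSet {q : ℝ × ℝ | q.1 ^ 2 + q.2 ^ 2 < R ^ 2} :=
    (isOpen_lt (by fun_prop) (by fun_prop)).measurableSet
  rw [setIntegral_Cyl_eq_prod, Measure.volume_eq_prod, ← setIntegral_prod_swap,
    setIntegral_prod (fun z : (ℝ × ℝ) × ℝ => pd 2 f ![z.swap.2.1, z.swap.2.2, z.swap.1]) hi'.swap]
  refine setIntegral_eq_zero_of_forall_eq_zero fun q hq => ?_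
  simp only [Measure.restrict_univ, Prod.swap]
  have hmem : ∀ t : ℝ, ![q.1, q.2, t] ∈ U := fun t =>
    hcl (subset_closure (by simpa [Cyl] using hq))
  have hcurve : ∀ t : ℝ, HasDerivAt (fun s : ℝ => (![q.1, q.2, s] : V3)) ![0, 0, 1] t := by
    intro t
    refine hasDerivAt_pi.2 fun i => ?_
    fin_cases i
    · simpa using hasDerivAt_const t q.1
    · simpa using hasDerivAt_const t q.2
    · simpa using! hasDerivAt_id t
  have hcc : Continuous (fun s : ℝ => (![q.1, q.2, s] : V3)) :=
    continuous_iff_continuousAt.2 fun t => (hcurve t).continuousAt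
  have hder : ∀ t : ℝ, HasDerivAt (fun s : ℝ => f ![q.1, q.2, s]) (pd 2 f ![q.1, q.2, t]) t := by
    intro t
    have hd : DifferentiableAt ℝ f ![q.1, q.2, t] :=
      (hf.differentiableOn one_ne_zero).differentiableAt (hU.mem_nhds (hmem t))
    simpa [Fin.sum_univ_three] using hasDerivAt_comp_curve hd (hcurve t)
  have hint : ∀ h : V3 → ℂ, ContinuousOn h U → (∀ x : V3, T + 1 ≤ |x 2| → h x = 0) →
      Integrable (fun t : ℝ => h ![q.1, q.2, t]) := by
    intro h hc h0
    refine (hc.comp_continuous hcc hmem).integrable_of_hasCompactSupport ?_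
    refine HasCompactSupport.intro (isCompact_Icc (a := -(T + 1)) (b := T + 1)) fun t ht => ?_
    refine h0 _ ?_
    by_contra hlt
    rw [not_le] at hlt
    exact ht ⟨(abs_lt.1 hlt).1.le, (abs_lt.1 hlt).2.le⟩
  exact integral_eq_zero_of_hasDerivAt_of_integrable hder
    (hint _ (continuousOn_pd hU hf 2) fun x hx => pd_eq_zero_of_axialSupp hT 2 (by linarith))
    (hint _ hf.continuousOn fun x hx => hT x (by linarith))

/-- The divergence theorem on the cylinder, for fields of compact axial support. -/
theorem setIntegral_Cyl_vdiv {R T : ℝ} (hR : 0 < R) {U : Set V3} (hU : IsOpen U)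
    (hcl : closure (Cyl R) ⊆ U) {F : V3 → C3} (hF : ∀ i, ContDiffOn ℝ 1 (fun x => F x i) U)
    (hT : ∀ x : V3, T ≤ |x 2| → F x = 0) :
    ∫ x in Cyl R, vdiv F x = surfInt R (fun x => ncomp R x (F x)) := by
  have hi : ∀ i j, IntegrableOn (pd j (fun x => F x i)) (Cyl R) := fun i j =>
    integrableOn_Cyl (T := T + 1) hR ((continuousOn_pd hU (hF i) j).mono hcl) fun x hx =>
      pd_eq_zero_of_axialSupp (T := T) (fun y hy => by simp [hT y hy]) j (by linarith)
  have hi2 : IntegrableOn (fun x => pd 0 (fun y => F y 0) x + pd 1 (fun y => F y 1) x) (Cyl R) :=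
    (hi 0 0).add (hi 1 1)
  simp only [vdiv, Fin.sum_univ_three]
  rw [integral_add hi2 (hi 2 2),
    setIntegral_Cyl_horizontal_divergence hR hU hcl (hF 0) (hF 1) hi2,
    setIntegral_Cyl_axial_derivative (T := T) hU hcl (hF 2) (fun y hy => by simp [hT y hy])
      (hi 2 2), add_zero]
  unfold surfInt
  refine integral_congr_ae (ae_of_all _ fun t => ?_)
  refine intervalIntegral.integral_congr fun θ _ => ?_
  simp [ncomp, nuR, polarPoint, Fin.sum_univ_three, hR.ne']
  ring

theorem pd_congr {U : Set V3} (hU : IsOpen U) {f g : V3 → ℂ} (h : Set.EqOn f g U) (j : Fin 3) :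
    Set.EqOn (pd j f) (pd j g) U := fun x hx => by
  have : f =ᶠ[nhds x] g := by
    filter_upwards [hU.mem_nhds hx] with y hy using h hy
  rw [pd, pd, this.fderiv_eq]

theorem pd_add {f g : V3 → ℂ} {x : V3} (hf : DifferentiableAt ℝ f x) (hg : DifferentiableAt ℝ g x)
    (j : Fin 3) : pd j (fun y => f y + g y) x = pd j f x + pd j g x := by
  simp only [pd, fderiv_fun_add hf hg, add_apply]

theorem pd_neg (f : V3 → ℂ) (x : V3) (j : Fin 3) : pd j (fun y => -f y) x = -pd j f x := by
  simp only [pd, fderiv_fun_neg, neg_apply]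

theorem pd_sum {f : Fin 3 → V3 → ℂ} {x : V3} (hf : ∀ i, DifferentiableAt ℝ (f i) x)
    (j : Fin 3) : pd j (fun y => ∑ i, f i y) x = ∑ i, pd j (f i) x := by
  simp only [pd, fderiv_fun_sum fun i _ => hf i, sum_apply]

theorem pd_mul {f g : V3 → ℂ} {x : V3} (hf : DifferentiableAt ℝ f x) (hg : DifferentiableAt ℝ g x)
    (j : Fin 3) : pd j (fun y => f y * g y) x = pd j f x * g x + f x * pd j g x := by
  simp only [pd, fderiv_fun_mul hf hg, add_apply,
    smul_apply, smul_eq_mul]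
  ring

theorem pd_const_mul {f : V3 → ℂ} {x : V3} (hf : DifferentiableAt ℝ f x) (c : ℂ) (j : Fin 3) :
    pd j (fun y => c * f y) x = c * pd j f x := by
  simp only [pd, fderiv_const_mul hf, smul_apply, smul_eq_mul]

theorem pd_conj (f : V3 → ℂ) (x : V3) (j : Fin 3) :
    pd j (fun y => (starRingEnd ℂ) (f y)) x = (starRingEnd ℂ) (pd j f x) := by
  have h := Complex.conjCLE.comp_fderiv (f := f) (x := x)
  have h2 : (fun y => (starRingEnd ℂ) (f y)) = Complex.conjCLE ∘ f := by ext; simp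
  rw [pd, h2, h]
  simp [pd]

theorem pd_ofReal {g : V3 → ℝ} {x : V3} (hg : DifferentiableAt ℝ g x) (j : Fin 3) :
    pd j (fun y => (g y : ℂ)) x = (pdR j g x : ℂ) := by
  have h := (Complex.ofRealCLM.hasFDerivAt.comp x hg.hasFDerivAt).fderiv
  have h2 : (fun y => (g y : ℂ)) = Complex.ofRealCLM ∘ g := by ext; simp
  rw [pd, h2, h]
  simp [pdR]

theorem pd_comm {U : Set V3} (hU : IsOpen U) {f : V3 → ℂ} (hf : ContDiffOn ℝ 2 f U) {x : V3}
    (hx : x ∈ U) (i j : Fin 3) : pd i (pd j f) x = pd j (pd i f) x := by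
  have hd : DifferentiableAt ℝ (fderiv ℝ f) x :=
    ((hf.fderiv_of_isOpen hU (m := 1) (by norm_num)).differentiableOn one_ne_zero).differentiableAt
      (hU.mem_nhds hx)
  have hs : IsSymmSndFDerivAt ℝ f x :=
    (hf.contDiffAt (hU.mem_nhds hx)).isSymmSndFDerivAt (by simp)
  have key : ∀ k l : Fin 3, pd k (pd l f) x
      = fderiv ℝ (fderiv ℝ f) x (Pi.single k 1) (Pi.single l 1) := by
    intro k l
    have h := fderiv_clm_apply hd (differentiableAt_const (Pi.single l (1 : ℝ)))
    change fderiv ℝ (fun y => fderiv ℝ f y (Pi.single l 1)) x (Pi.single k 1) = _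
    rw [h]
    simp
  rw [key, key]
  exact hs _ _

/-- The flux whose divergence is the difference of the two integrands. -/
def flux (e : V3 → ℂ) (a b : Fin 3 → V3 → ℂ) (x : V3) : C3 := fun i =>
  -(1 / 2 * (pd i e x * ∑ k, a k x * b k x) + e x * ∑ j, b j x * pd j (a i) x)

theorem curl_energy_algebra {s : ℂ} {σ : Fin 3 → ℂ} {E : Fin 3 → Fin 3 → ℂ} {u b : Fin 3 → ℂ}
    {p q : Fin 3 → Fin 3 → ℂ} {P : Fin 3 → Fin 3 → Fin 3 → ℂ} (hs : s ≠ 0)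
    (hP : ∀ i j k, P i j k = P i k j)
    (hE : ∀ j k, E j k = E k j)
    (hD : ∑ i, (2 * s * σ i * u i + s * s * p i i) = 0)
    (hD' : ∀ j, ∑ i, (E j i * u i + 2 * s * σ i * p i j
      + (2 * s * σ j * p i i + s * s * P i i j)) = 0) :
    s * s * ((p 2 1 - p 1 2) * (q 2 1 - q 1 2) + (p 0 2 - p 2 0) * (q 0 2 - q 2 0)
        + (p 1 0 - p 0 1) * (q 1 0 - q 0 1))
      = ∑ j, ∑ i, (σ j * u i + s * p i j) * (σ j * b i + s * q i j)
        + s * s * ∑ j, (∑ k, (((2 * (s * s))⁻¹ * ∑ i, E i i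
            - (4 * (s * s) ^ 2)⁻¹ * ∑ i, (2 * s * σ i) ^ 2) * (if j = k then 1 else 0)
          + ((s * s) ^ 2)⁻¹ * (2 * s * σ j) * (2 * s * σ k) - (s * s)⁻¹ * E j k) * u k) * b j
        + ∑ i, -(1 / 2 * (E i i * ∑ k, u k * b k
              + 2 * s * σ i * ∑ k, (p k i * b k + u k * q k i))
            + (2 * s * σ i * ∑ j, b j * p i j
              + s * s * ∑ j, (q j i * p i j + b j * P i j i))) := by
  have hW : ∀ j k, s * s * (((2 * (s * s))⁻¹ * ∑ i, E i i
      - (4 * (s * s) ^ 2)⁻¹ * ∑ i, (2 * s * σ i) ^ 2) * (if j = k then 1 else 0)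
      + ((s * s) ^ 2)⁻¹ * (2 * s * σ j) * (2 * s * σ k) - (s * s)⁻¹ * E j k)
      = (1 / 2 * ∑ i, E i i - ∑ i, σ i ^ 2) * (if j = k then 1 else 0) + 4 * σ j * σ k - E j k := by
    intro j k
    simp only [Fin.sum_univ_three]
    field_simp
    ring
  have hD0 : ∑ i, (2 * σ i * u i + s * p i i) = 0 := by
    refine (mul_eq_zero.1 ?_).resolve_left hs
    rw [← hD, Finset.mul_sum]
    exact Finset.sum_congr rfl fun i _ => by ring
  have hWs : s * s * ∑ j, (∑ k, (((2 * (s * s))⁻¹ * ∑ i, E i i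
      - (4 * (s * s) ^ 2)⁻¹ * ∑ i, (2 * s * σ i) ^ 2) * (if j = k then 1 else 0)
      + ((s * s) ^ 2)⁻¹ * (2 * s * σ j) * (2 * s * σ k) - (s * s)⁻¹ * E j k) * u k) * b j
      = ∑ j, (∑ k, ((1 / 2 * ∑ i, E i i - ∑ i, σ i ^ 2) * (if j = k then 1 else 0)
        + 4 * σ j * σ k - E j k) * u k) * b j := by
    rw [Finset.mul_sum]
    refine Finset.sum_congr rfl fun j _ => ?_
    rw [← mul_assoc, Finset.mul_sum]
    congr 1
    refine Finset.sum_congr rfl fun k _ => ?_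
    rw [← mul_assoc, hW]
  rw [hWs]
  have h0 := hD' 0
  have h1 := hD' 1
  have h2 := hD' 2
  simp only [Fin.sum_univ_three, Fin.isValue, Fin.reduceEq, if_true, if_false] at h0 h1 h2 hD0 ⊢
  rw [hE 1 0] at h1 ⊢
  rw [hE 2 0, hE 2 1] at h2 ⊢
  rw [hP 0 1 0, hP 0 2 0, hP 1 2 1, hP 1 0 1, hP 2 0 2, hP 2 1 2]
  linear_combination b 0 * h0 + b 1 * h1 + b 2 * h2
    - 2 * (σ 0 * b 0 + σ 1 * b 1 + σ 2 * b 2) * hD0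

theorem differentiableAt_of_contDiffOn {U : Set V3} (hU : IsOpen U) {n : WithTop ℕ∞} (hn : n ≠ 0)
    {f : V3 → ℂ} (hf : ContDiffOn ℝ n f U) {x : V3} (hx : x ∈ U) : DifferentiableAt ℝ f x :=
  (hf.differentiableOn hn).differentiableAt (hU.mem_nhds hx)

theorem contDiffOn_flux {U : Set V3} (hU : IsOpen U) {e : V3 → ℂ} {a b : Fin 3 → V3 → ℂ}
    (he : ContDiffOn ℝ 2 e U) (ha : ∀ i, ContDiffOn ℝ 2 (a i) U)
    (hb : ∀ i, ContDiffOn ℝ 2 (b i) U) (i : Fin 3) :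
    ContDiffOn ℝ 1 (fun x => flux e a b x i) U := by
  have ha1 := fun k => (ha k).of_le one_le_two
  have hb1 := fun k => (hb k).of_le one_le_two
  have he1 := he.of_le one_le_two
  exact ((contDiffOn_const.mul ((contDiffOn_pd hU he i).mul
    (ContDiffOn.sum fun k _ => (ha1 k).mul (hb1 k)))).add
    (he1.mul (ContDiffOn.sum fun j _ => (hb1 j).mul (contDiffOn_pd hU (ha i) j)))).neg

theorem curl_mul_curl_eq {U : Set V3} (hU : IsOpen U) {s e : V3 → ℂ} {a b : Fin 3 → V3 → ℂ}
    (hs : ContDiffOn ℝ 2 s U) (he : ContDiffOn ℝ 2 e U) (ha : ∀ i, ContDiffOn ℝ 2 (a i) U)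
    (hb : ∀ i, ContDiffOn ℝ 2 (b i) U) (hs0 : ∀ x ∈ U, s x ≠ 0)
    (hes : ∀ x ∈ U, e x = s x * s x)
    (hdiv : ∀ x ∈ U, ∑ i, (pd i e x * a i x + e x * pd i (a i) x) = 0) {x : V3} (hx : x ∈ U) :
    e x * ((pd 1 (a 2) x - pd 2 (a 1) x) * (pd 1 (b 2) x - pd 2 (b 1) x)
        + (pd 2 (a 0) x - pd 0 (a 2) x) * (pd 2 (b 0) x - pd 0 (b 2) x)
        + (pd 0 (a 1) x - pd 1 (a 0) x) * (pd 0 (b 1) x - pd 1 (b 0) x))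
      = ∑ j, ∑ i, pd j (fun y => s y * a i y) x * pd j (fun y => s y * b i y) x
        + e x * ∑ j, (∑ k, (((2 * e x)⁻¹ * ∑ i, pd i (pd i e) x
            - (4 * e x ^ 2)⁻¹ * ∑ i, pd i e x ^ 2) * (if j = k then 1 else 0)
          + (e x ^ 2)⁻¹ * pd j e x * pd k e x - (e x)⁻¹ * pd j (pd k e) x) * a k x) * b j x
        + vdiv (flux e a b) x := by
  have d1 {f : V3 → ℂ} (hf : ContDiffOn ℝ 1 f U) : DifferentiableAt ℝ f x :=
    differentiableAt_of_contDiffOn hU one_ne_zero hf hx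
  have d2 {f : V3 → ℂ} (hf : ContDiffOn ℝ 2 f U) : DifferentiableAt ℝ f x :=
    differentiableAt_of_contDiffOn hU two_ne_zero hf hx
  have dpd {f : V3 → ℂ} (hf : ContDiffOn ℝ 2 f U) (j : Fin 3) : DifferentiableAt ℝ (pd j f) x :=
    d1 (contDiffOn_pd hU hf j)
  have hpe : ∀ i, pd i e x = 2 * s x * pd i s x := fun i => by
    rw [pd_congr hU hes i hx, pd_mul (d2 hs) (d2 hs)]
    ring
  have hflux : vdiv (flux e a b) x
      = ∑ i, -(1 / 2 * (pd i (pd i e) x * ∑ k, a k x * b k x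
              + pd i e x * ∑ k, (pd i (a k) x * b k x + a k x * pd i (b k) x))
            + (pd i e x * ∑ j, b j x * pd j (a i) x
              + e x * ∑ j, (pd i (b j) x * pd j (a i) x + b j x * pd i (pd j (a i)) x))) := by
    refine Finset.sum_congr rfl fun i _ => ?_
    simp only [flux]
    have dab : ∀ k, DifferentiableAt ℝ (fun y => a k y * b k y) x :=
      fun k => (d2 (ha k)).mul (d2 (hb k))
    have dbp : ∀ k, DifferentiableAt ℝ (fun y => b k y * pd k (a i) y) x :=
      fun k => (d2 (hb k)).mul (dpd (ha i) k)
    have dsum : DifferentiableAt ℝ (fun y => ∑ k, a k y * b k y) x :=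
      DifferentiableAt.fun_sum fun k _ => dab k
    have dsum' : DifferentiableAt ℝ (fun y => ∑ k, b k y * pd k (a i) y) x :=
      DifferentiableAt.fun_sum fun k _ => dbp k
    have dh : DifferentiableAt ℝ (fun y => pd i e y * ∑ k, a k y * b k y) x :=
      (dpd he i).mul dsum
    rw [pd_neg, pd_add (dh.const_mul _) ((d2 he).fun_mul dsum'), pd_const_mul dh,
      pd_mul (dpd he i) dsum, pd_mul (d2 he) dsum', pd_sum dab, pd_sum dbp]
    simp only [fun k => pd_mul (d2 (ha k)) (d2 (hb k)) i,
      fun k => pd_mul (d2 (hb k)) (dpd (ha i) k) i]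
  have hD' : ∀ j, ∑ i, (pd j (pd i e) x * a i x + pd i e x * pd j (a i) x
      + (pd j e x * pd i (a i) x + e x * pd j (pd i (a i)) x)) = 0 := by
    intro j
    have h0 : pd j (fun y => ∑ i, (pd i e y * a i y + e y * pd i (a i) y)) x = 0 := by
      rw [pd_congr (g := fun _ => 0) hU (fun y hy => hdiv y hy) j hx]
      simp [pd]
    have dm : ∀ i, DifferentiableAt ℝ (fun y => pd i e y * a i y) x :=
      fun i => (dpd he i).mul (d2 (ha i))
    have dm' : ∀ i, DifferentiableAt ℝ (fun y => e y * pd i (a i) y) x :=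
      fun i => (d2 he).mul (dpd (ha i) i)
    rw [pd_sum fun i => (dm i).fun_add (dm' i)] at h0
    rw [← h0]
    refine Finset.sum_congr rfl fun i _ => ?_
    rw [pd_add (dm i) (dm' i), pd_mul (dpd he i) (d2 (ha i)), pd_mul (d2 he) (dpd (ha i) i)]
  have hD := hdiv x hx
  rw [hflux]
  simp only [fun i j => pd_mul (d2 hs) (d2 (ha i)) j, fun i j => pd_mul (d2 hs) (d2 (hb i)) j]
  simp only [hpe, hes x hx] at hD hD' ⊢
  exact curl_energy_algebra (σ := fun i => pd i s x) (E := fun j k => pd j (pd k e) x)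
    (u := fun i => a i x) (b := fun i => b i x) (p := fun i j => pd j (a i) x)
    (q := fun i j => pd j (b i) x) (P := fun i j k => pd k (pd j (a i)) x) (hs0 x hx)
    (fun i j k => pd_comm hU (ha i) hx k j) (fun j k => pd_comm hU he hx j k) hD hD'

theorem hasDerivAt_polarPoint_axis (p : ℝ × ℝ) (t : ℝ) :
    HasDerivAt (fun s => polarPoint s p) ![0, 0, 1] t := by
  refine hasDerivAt_pi.2 fun i => ?_
  fin_cases i
  · simpa [polarPoint] using hasDerivAt_const t (p.1 * Real.cos p.2)
  · simpa [polarPoint] using hasDerivAt_const t (p.1 * Real.sin p.2)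
  · simpa [polarPoint] using! hasDerivAt_id t

theorem polarPoint_mem_bCyl (R t θ : ℝ) : polarPoint t (R, θ) ∈ bCyl R := by
  simp only [bCyl, polarPoint, Set.mem_ofPred_eq, Matrix.cons_val_zero, Matrix.cons_val_one]
  linear_combination R ^ 2 * Real.sin_sq_add_cos_sq θ

theorem nuR_polarPoint {R : ℝ} (hR : 0 < R) (t θ : ℝ) :
    nuR R (polarPoint t (R, θ)) = ![Real.cos θ, Real.sin θ, 0] := by
  simp [nuR, polarPoint, hR.ne']

theorem ncomp_flux_polarPoint {R : ℝ} (hR : 0 < R) {U : Set V3} (hU : IsOpen U)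
    (hcl : closure (Cyl R) ⊆ U) {e : V3 → ℂ} {a b : Fin 3 → V3 → ℂ}
    (he : ContDiffOn ℝ 2 e U) (ha : ∀ i, ContDiffOn ℝ 2 (a i) U)
    (hdiv : ∀ x ∈ Cyl R, ∑ i, (pd i e x * a i x + e x * pd i (a i) x) = 0)
    (habc : ∀ x ∈ bCyl R, ∀ i, a i x = ncomp R x (fun k => a k x) * (nuR R x i : ℂ))
    (hbbc : ∀ x ∈ bCyl R, ∀ i, b i x = ncomp R x (fun k => b k x) * (nuR R x i : ℂ))
    (t θ : ℝ) {x : V3} (hx : x = polarPoint t (R, θ)) :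
    ncomp R x (flux e a b x)
      = (e x * (R : ℂ)⁻¹ + 1 / 2 * ∑ k, pd k e x * (nuR R x k : ℂ)) * ∑ k, a k x * b k x := by
  have hcl' : ∀ t θ, polarPoint t (R, θ) ∈ closure (Cyl R) := fun t θ =>
    polarPoint_mem_closure hR ⟨hR.le, le_rfl⟩
  have hxc : x ∈ closure (Cyl R) := hx ▸ hcl' t θ
  have da : ∀ i, DifferentiableAt ℝ (a i) (polarPoint t (R, θ)) := fun i =>
    differentiableAt_of_contDiffOn hU two_ne_zero (ha i) (hcl (hcl' t θ))
  have hD : ∑ i, (pd i e x * a i x + e x * pd i (a i) x) = 0 := by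
    have hc : ContinuousOn (fun x => ∑ i, (pd i e x * a i x + e x * pd i (a i) x))
        (closure (Cyl R)) := by
      refine ContinuousOn.mono (continuousOn_finsetSum _ fun i _ => ?_) hcl
      exact ((contDiffOn_pd hU he i).continuousOn.mul (ha i).continuousOn).add
        (he.continuousOn.mul (contDiffOn_pd hU (ha i) i).continuousOn)
    exact Set.EqOn.of_subset_closure (g := fun _ => (0 : ℂ)) (fun y hy => hdiv y hy) hc
      continuousOn_const subset_closure subset_rfl hxc
  have hcs : (Real.sin θ : ℂ) ^ 2 + (Real.cos θ : ℂ) ^ 2 = 1 := by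
    exact_mod_cast Real.sin_sq_add_cos_sq θ
  have hRC : (R : ℂ) ≠ 0 := by exact_mod_cast hR.ne'
  have haxis : pd 2 (a 2) x = 0 := by
    have h := hasDerivAt_comp_curve (da 2) (hasDerivAt_polarPoint_axis (R, θ) t)
    have h0 : (fun r => a 2 (polarPoint r (R, θ))) = fun _ => 0 := by
      ext r
      rw [habc _ (polarPoint_mem_bCyl R r θ), nuR_polarPoint hR]
      simp
    rw [h0] at h
    have := h.unique (hasDerivAt_const t (0 : ℂ))
    simpa [Fin.sum_univ_three, ← hx] using this
  have htan : -(Real.cos θ : ℂ) * a 0 x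
      + -(Real.sin θ : ℂ) * (-(R * Real.sin θ) * pd 0 (a 0) x + R * Real.cos θ * pd 1 (a 0) x)
      + (-(Real.sin θ : ℂ) * a 1 x
      + Real.cos θ * (-(R * Real.sin θ) * pd 0 (a 1) x + R * Real.cos θ * pd 1 (a 1) x)) = 0 := by
    have h0 := hasDerivAt_comp_curve (da 0) (hasDerivAt_polarPoint_angle t R θ)
    have h1 := hasDerivAt_comp_curve (da 1) (hasDerivAt_polarPoint_angle t R θ)
    have hc : HasDerivAt (fun s : ℝ => (Real.cos s : ℂ)) ((-Real.sin θ : ℝ) : ℂ) θ :=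
      (Real.hasDerivAt_cos θ).ofReal_comp
    have hs : HasDerivAt (fun s : ℝ => (Real.sin s : ℂ)) ((Real.cos θ : ℝ) : ℂ) θ :=
      (Real.hasDerivAt_sin θ).ofReal_comp
    have h := (hs.fun_neg.fun_mul h0).fun_add (hc.fun_mul h1)
    have hz : (fun r : ℝ => -(Real.sin r : ℂ) * a 0 (polarPoint t (R, r))
        + (Real.cos r : ℂ) * a 1 (polarPoint t (R, r))) = fun _ => 0 := by
      ext r
      rw [habc _ (polarPoint_mem_bCyl R t r) 0, habc _ (polarPoint_mem_bCyl R t r) 1,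
        nuR_polarPoint hR]
      simp only [Matrix.cons_val_zero, Matrix.cons_val_one]
      ring
    rw [hz] at h
    have h2 := h.unique (hasDerivAt_const θ (0 : ℂ))
    rw [← hx] at h2
    simp only [Fin.sum_univ_three, Matrix.cons_val_zero, Matrix.cons_val_one, Matrix.cons_val,
      Complex.ofReal_neg, Complex.ofReal_mul, Complex.ofReal_zero, zero_mul, add_zero] at h2
    exact h2
  have hxb : x ∈ bCyl R := hx ▸ polarPoint_mem_bCyl R t θ
  have hν : nuR R x = ![Real.cos θ, Real.sin θ, 0] := hx ▸ nuR_polarPoint hR t θ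
  have ha' := habc x hxb
  have hb' := hbbc x hxb
  generalize ncomp R x (fun k => a k x) = α at ha'
  generalize ncomp R x (fun k => b k x) = β at hb'
  have ha0 := ha' 0
  have ha1 := ha' 1
  have ha2 := ha' 2
  have hb0 := hb' 0
  have hb1 := hb' 1
  have hb2 := hb' 2
  simp only [ncomp, flux]
  rw [hν] at *
  simp only [Fin.sum_univ_three, Matrix.cons_val_zero, Matrix.cons_val_one, Matrix.cons_val,
    Complex.ofReal_zero, mul_zero, add_zero] at *
  rw [ha0, ha1, ha2, haxis] at hD
  rw [ha0, ha1] at htan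
  rw [ha0, ha1, ha2, hb0, hb1, hb2]
  generalize (Real.cos θ : ℂ) = c at *
  generalize (Real.sin θ : ℂ) = s at *
  have hRi : (R : ℂ) * (R : ℂ)⁻¹ = 1 := mul_inv_cancel₀ hRC
  linear_combination -β * hD + e x * β * (R : ℂ)⁻¹ * htan
    - ((pd 0 e x * c + pd 1 e x * s) * α * β + e x * β * (pd 0 (a 0) x + pd 1 (a 1) x)) * hcs
    - e x * β * (s ^ 2 * pd 0 (a 0) x - s * c * (pd 1 (a 0) x + pd 0 (a 1) x)
      + c ^ 2 * pd 1 (a 1) x) * hRi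

theorem contDiffOn_pdR {U : Set V3} (hU : IsOpen U) {f : V3 → ℝ} (hf : ContDiffOn ℝ 2 f U)
    (j : Fin 3) : ContDiffOn ℝ 1 (pdR j f) U :=
  (hf.fderiv_of_isOpen hU (by norm_num)).clm_apply contDiffOn_const

theorem contDiffOn_ofReal {U : Set V3} {n : WithTop ℕ∞} {f : V3 → ℝ} (hf : ContDiffOn ℝ n f U) :
    ContDiffOn ℝ n (fun y => (f y : ℂ)) U :=
  Complex.ofRealCLM.contDiff.comp_contDiffOn hf

theorem pd_pd_ofReal {U : Set V3} (hU : IsOpen U) {f : V3 → ℝ} (hf : ContDiffOn ℝ 2 f U)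
    {x : V3} (hx : x ∈ U) (j k : Fin 3) :
    pd j (pd k fun y => (f y : ℂ)) x = (pdR j (fun y => pdR k f y) x : ℂ) := by
  rw [← pd_ofReal (((contDiffOn_pdR hU hf k).differentiableOn one_ne_zero).differentiableAt
    (hU.mem_nhds hx))]
  exact pd_congr hU (fun y hy => pd_ofReal
    ((hf.differentiableOn two_ne_zero).differentiableAt (hU.mem_nhds hy)) k) j hx

/-- The components of the conjugate of `(ε μ)⁻¹ w`. -/
def scaledConj (ε μ : V3 → ℝ) (w : V3 → C3) (i : Fin 3) (y : V3) : ℂ :=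
  (starRingEnd ℂ) (w y i) * (((ε y * μ y)⁻¹ : ℝ) : ℂ)

theorem contDiffOn_scaledConj {U : Set V3} {ε μ : V3 → ℝ} {w : V3 → C3}
    (hε : ContDiffOn ℝ 2 ε U) (hμ : ContDiffOn ℝ 2 μ U) (hw : ContDiffOn ℝ 2 w U)
    (hεpos : ∀ x ∈ U, 0 < ε x) (hμpos : ∀ x ∈ U, 0 < μ x) (i : Fin 3) :
    ContDiffOn ℝ 2 (scaledConj ε μ w i) U :=
  (Complex.conjCLE.contDiff.comp_contDiffOn (contDiffOn_pi.1 hw i)).mul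
    (contDiffOn_ofReal ((hε.mul hμ).inv fun x hx => (mul_pos (hεpos x hx) (hμpos x hx)).ne'))

theorem hinner_vcurl_eq {U : Set V3} (hU : IsOpen U) {ε μ : V3 → ℝ} {u w : V3 → C3}
    (hε : ContDiffOn ℝ 2 ε U) (hμ : ContDiffOn ℝ 2 μ U) (hu : ContDiffOn ℝ 2 u U)
    (hw : ContDiffOn ℝ 2 w U) (hεpos : ∀ x ∈ U, 0 < ε x) (hμpos : ∀ x ∈ U, 0 < μ x)
    (hdiv : ∀ x ∈ U, ∑ i, (pd i (fun y => (ε y : ℂ)) x * u x i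
      + (ε x : ℂ) * pd i (fun y => u y i) x) = 0) {x : V3} (hx : x ∈ U) :
    (((μ x)⁻¹ : ℝ) : ℂ) * hinner (vcurl u x) (vcurl w x)
      = (∑ j, hinner (pdV j (fun y => (Real.sqrt (ε y) : ℂ) • u y) x)
            (pdV j (fun y => (((Real.sqrt (ε y))⁻¹ * (μ y)⁻¹ : ℝ) : ℂ) • w y) x))
        - hinner (vcurl u x)
            ((ε x : ℂ) • cross (gradC (fun y => (ε y * μ y)⁻¹) x) (w x))
        + (((μ x)⁻¹ : ℝ) : ℂ) * hinner (fun j => ∑ k, (Wm ε x j k : ℂ) * u x k) (w x)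
        + vdiv (flux (fun y => (ε y : ℂ)) (fun i y => u y i) (scaledConj ε μ w)) x := by
  have hsqrt : ContDiffOn ℝ 2 (fun y => (Real.sqrt (ε y) : ℂ)) U :=
    contDiffOn_ofReal (hε.sqrt fun y hy => (hεpos y hy).ne')
  have key := curl_mul_curl_eq hU hsqrt (contDiffOn_ofReal hε) (fun i => contDiffOn_pi.1 hu i)
    (contDiffOn_scaledConj hε hμ hw hεpos hμpos)
    (fun y hy => by exact_mod_cast (Real.sqrt_pos.2 (hεpos y hy)).ne')
    (fun y hy => by exact_mod_cast (Real.mul_self_sqrt (hεpos y hy).le).symm) hdiv hx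
  have hε0 : (ε x : ℂ) ≠ 0 := by exact_mod_cast (hεpos x hx).ne'
  have hμ0 : (μ x : ℂ) ≠ 0 := by exact_mod_cast (hμpos x hx).ne'
  have dε : DifferentiableAt ℝ ε x :=
    (hε.differentiableOn two_ne_zero).differentiableAt (hU.mem_nhds hx)
  have dg : DifferentiableAt ℝ (fun y => (ε y * μ y)⁻¹) x :=
    (((hε.mul hμ).inv fun y hy => (mul_pos (hεpos y hy) (hμpos y hy)).ne').differentiableOn
      two_ne_zero).differentiableAt (hU.mem_nhds hx)
  have dgC : DifferentiableAt ℝ (fun y => (((ε y * μ y)⁻¹ : ℝ) : ℂ)) x :=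
    Complex.ofRealCLM.differentiableAt.comp x dg
  have dw : ∀ i, DifferentiableAt ℝ (fun y => (starRingEnd ℂ) (w y i)) x := fun i =>
    differentiableAt_of_contDiffOn hU two_ne_zero
      (Complex.conjCLE.contDiff.comp_contDiffOn (contDiffOn_pi.1 hw i)) hx
  have hb : ∀ i j, pd j (scaledConj ε μ w i) x
      = (starRingEnd ℂ) (pd j (fun y => w y i) x) * ((ε x : ℂ) * (μ x : ℂ))⁻¹
        + (starRingEnd ℂ) (w x i) * (pdR j (fun y => (ε y * μ y)⁻¹) x : ℂ) := fun i j => by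
    rw [← pd_conj, ← pd_ofReal dg]
    refine (pd_mul (dw i) dgC j).trans ?_
    push_cast
    rfl
  have hA : ∀ j, hinner (pdV j (fun y => (Real.sqrt (ε y) : ℂ) • u y) x)
      (pdV j (fun y => (((Real.sqrt (ε y))⁻¹ * (μ y)⁻¹ : ℝ) : ℂ) • w y) x)
      = ∑ i, pd j (fun y => (Real.sqrt (ε y) : ℂ) * u y i) x
        * pd j (fun y => (Real.sqrt (ε y) : ℂ) * scaledConj ε μ w i y) x := fun j => by
    refine Finset.sum_congr rfl fun i _ => ?_
    simp only [pdV, ← pd_conj]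
    congr 1
    refine pd_congr hU (fun y hy => ?_) j hx
    have h1 : (Real.sqrt (ε y) : ℂ) * (Real.sqrt (ε y) : ℂ) = (ε y : ℂ) := by
      exact_mod_cast Real.mul_self_sqrt (hεpos y hy).le
    have h2 : (Real.sqrt (ε y) : ℂ) ≠ 0 := by
      exact_mod_cast (Real.sqrt_pos.2 (hεpos y hy)).ne'
    simp only [Pi.smul_apply, smul_eq_mul, map_mul, Complex.conj_ofReal, scaledConj]
    push_cast
    rw [← h1, mul_inv, mul_inv]
    field_simp
  have hW : ∀ j k, (Wm ε x j k : ℂ)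
      = ((2 * (ε x : ℂ))⁻¹ * ∑ i, pd i (pd i fun y => (ε y : ℂ)) x
            - (4 * (ε x : ℂ) ^ 2)⁻¹ * ∑ i, pd i (fun y => (ε y : ℂ)) x ^ 2)
          * (if j = k then 1 else 0)
          + ((ε x : ℂ) ^ 2)⁻¹ * pd j (fun y => (ε y : ℂ)) x * pd k (fun y => (ε y : ℂ)) x
          - (ε x : ℂ)⁻¹ * pd j (pd k fun y => (ε y : ℂ)) x := fun j k => by
    simp only [pd_pd_ofReal hU hε hx, pd_ofReal dε, Wm, lapR]
    split_ifs <;> push_cast <;> rfl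
  simp only [← hW] at key
  simp only [hA]
  have hC : (((μ x)⁻¹ : ℝ) : ℂ) * hinner (fun j => ∑ k, (Wm ε x j k : ℂ) * u x k) (w x)
      = ε x * ∑ j, (∑ k, (Wm ε x j k : ℂ) * u x k) * scaledConj ε μ w j x := by
    simp only [hinner, Finset.mul_sum, scaledConj]
    refine Finset.sum_congr rfl fun j _ => ?_
    push_cast
    field_simp
  rw [hC]
  have hL : (((μ x)⁻¹ : ℝ) : ℂ) * hinner (vcurl u x) (vcurl w x) + hinner (vcurl u x)
            ((ε x : ℂ) • cross (gradC (fun y => (ε y * μ y)⁻¹) x) (w x))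
      = ε x * ((pd 1 (fun y => u y 2) x - pd 2 (fun y => u y 1) x)
          * (pd 1 (scaledConj ε μ w 2) x - pd 2 (scaledConj ε μ w 1) x)
        + (pd 2 (fun y => u y 0) x - pd 0 (fun y => u y 2) x)
          * (pd 2 (scaledConj ε μ w 0) x - pd 0 (scaledConj ε μ w 2) x)
        + (pd 0 (fun y => u y 1) x - pd 1 (fun y => u y 0) x)
          * (pd 0 (scaledConj ε μ w 1) x - pd 1 (scaledConj ε μ w 0) x)) := by
    simp only [hb, hinner, vcurl, cross, gradC, Fin.sum_univ_three, Pi.smul_apply, smul_eq_mul,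
      Matrix.cons_val_zero, Matrix.cons_val_one, Matrix.cons_val, map_mul, map_sub,
      Complex.conj_ofReal]
    push_cast
    field_simp
    ring
  linear_combination hL + key

theorem exists_common_nhds {S : Set V3} {ε μ : V3 → ℝ} {u w : V3 → C3}
    (hε : UpTo 2 S ε) (hμ : UpTo 2 S μ) (hεpos : ∀ x ∈ closure S, 0 < ε x)
    (hμpos : ∀ x ∈ closure S, 0 < μ x) (hu : UpTo 2 S u) (hw : UpTo 2 S w) :
    ∃ U : Set V3, IsOpen U ∧ closure S ⊆ U ∧ ContDiffOn ℝ 2 ε U ∧ ContDiffOn ℝ 2 μ U ∧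
      ContDiffOn ℝ 2 u U ∧ ContDiffOn ℝ 2 w U ∧ (∀ x ∈ U, 0 < ε x) ∧ ∀ x ∈ U, 0 < μ x := by
  obtain ⟨Uε, hUε, hSε, hε⟩ := hε
  obtain ⟨Uμ, hUμ, hSμ, hμ⟩ := hμ
  obtain ⟨Uu, hUu, hSu, hu⟩ := hu
  obtain ⟨Uw, hUw, hSw, hw⟩ := hw
  refine ⟨(Uε ∩ ε ⁻¹' Set.Ioi 0) ∩ (Uμ ∩ μ ⁻¹' Set.Ioi 0) ∩ (Uu ∩ Uw),
    ((hε.continuousOn.isOpen_inter_preimage hUε isOpen_Ioi).inter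
      (hμ.continuousOn.isOpen_inter_preimage hUμ isOpen_Ioi)).inter (hUu.inter hUw),
    fun x hx => ⟨⟨⟨hSε hx, hεpos x hx⟩, hSμ hx, hμpos x hx⟩, hSu hx, hSw hx⟩,
    hε.mono fun x hx => hx.1.1.1, hμ.mono fun x hx => hx.1.2.1, hu.mono fun x hx => hx.2.1,
    hw.mono fun x hx => hx.2.2, fun x hx => hx.1.1.2, fun x hx => hx.1.2.2⟩

theorem continuousOn_hinner {U : Set V3} {a b : V3 → C3} (ha : ContinuousOn a U)
    (hb : ContinuousOn b U) : ContinuousOn (fun x => hinner (a x) (b x)) U :=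
  continuousOn_finsetSum _ fun i _ => (continuousOn_pi.1 ha i).mul
    (Complex.continuous_conj.comp_continuousOn (continuousOn_pi.1 hb i))

theorem continuousOn_pdV {U : Set V3} (hU : IsOpen U) {a : V3 → C3} (ha : ContDiffOn ℝ 1 a U)
    (j : Fin 3) : ContinuousOn (pdV j a) U :=
  continuousOn_pi.2 fun i => continuousOn_pd hU (contDiffOn_pi.1 ha i) j

theorem continuousOn_vcurl {U : Set V3} (hU : IsOpen U) {a : V3 → C3} (ha : ContDiffOn ℝ 1 a U) :
    ContinuousOn (vcurl a) U := by
  have h := fun i j => continuousOn_pd hU (contDiffOn_pi.1 ha i) j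
  refine continuousOn_pi.2 fun i => ?_
  fin_cases i
  exacts [(h 2 1).sub (h 1 2), (h 0 2).sub (h 2 0), (h 1 0).sub (h 0 1)]

theorem continuousOn_cross {U : Set V3} {a b : V3 → C3} (ha : ContinuousOn a U)
    (hb : ContinuousOn b U) : ContinuousOn (fun x => cross (a x) (b x)) U := by
  have h := fun i j => (continuousOn_pi.1 ha i).mul (continuousOn_pi.1 hb j)
  refine continuousOn_pi.2 fun i => ?_
  fin_cases i
  exacts [(h 1 2).sub (h 2 1), (h 2 0).sub (h 0 2), (h 0 1).sub (h 1 0)]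

theorem continuousOn_Wm {U : Set V3} (hU : IsOpen U) {ε : V3 → ℝ} (hε : ContDiffOn ℝ 2 ε U)
    (hεpos : ∀ x ∈ U, 0 < ε x) (j k : Fin 3) : ContinuousOn (fun x => Wm ε x j k) U := by
  have h0 := hε.continuousOn
  have h1 := fun j => (contDiffOn_pdR hU hε j).continuousOn
  have h2 : ∀ j k, ContinuousOn (fun x => pdR j (fun y => pdR k ε y) x) U := fun j k =>
    ((contDiffOn_pdR hU hε k).continuousOn_fderiv_of_isOpen hU le_rfl).clm_apply
      continuousOn_const
  have hne := fun x hx => (hεpos x hx).ne'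
  refine ContinuousOn.sub (ContinuousOn.add (ContinuousOn.mul (ContinuousOn.sub
    (ContinuousOn.mul ?_ ?_) (ContinuousOn.mul ?_ ?_)) continuousOn_const)
    (ContinuousOn.mul (ContinuousOn.mul ?_ (h1 j)) (h1 k))) (ContinuousOn.mul ?_ (h2 j k))
  · exact (continuousOn_const.mul h0).inv₀ fun x hx => mul_ne_zero two_ne_zero (hne x hx)
  · exact continuousOn_finsetSum _ fun i _ => h2 i i
  · exact (continuousOn_const.mul (h0.pow 2)).inv₀ fun x hx =>
      mul_ne_zero four_ne_zero (pow_ne_zero 2 (hne x hx))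
  · exact continuousOn_finsetSum _ fun i _ => (h1 i).pow 2
  · exact (h0.pow 2).inv₀ fun x hx => pow_ne_zero 2 (hne x hx)
  · exact h0.inv₀ hne

theorem vcurl_eq_zero_of_axialSupp {a : V3 → C3} {T : ℝ} (ha : ∀ x : V3, T ≤ |x 2| → a x = 0)
    {x : V3} (hx : T < |x 2|) : vcurl a x = 0 := by
  have h : ∀ i j, pd j (fun y => a y i) x = 0 := fun i j =>
    pd_eq_zero_of_axialSupp (fun y hy => congrFun (ha y hy) i) j hx
  ext i
  fin_cases i <;> simp [vcurl, h]

theorem hinner_zero_left (b : C3) : hinner 0 b = 0 := by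
  simp [hinner]

theorem flux_eq_zero_of_axialSupp {a : Fin 3 → V3 → ℂ} {T : ℝ}
    (ha : ∀ i, ∀ x : V3, T ≤ |x 2| → a i x = 0) (e : V3 → ℂ) (b : Fin 3 → V3 → ℂ) {x : V3}
    (hx : T < |x 2|) : flux e a b x = 0 := by
  ext i
  simp [flux, ha _ x hx.le, fun i j => pd_eq_zero_of_axialSupp (ha i) j hx]

/-- the identity of Lemma 3.3 (u and w with vanishing tangential components). -/
theorem statement12 (R : ℝ) (hR : 0 < R) (ε μ : V3 → ℝ) (u w : V3 → C3)
    (hε : UpTo 2 (Cyl R) ε) (hμ : UpTo 2 (Cyl R) μ)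
    (hεpos : ∀ x ∈ closure (Cyl R), 0 < ε x) (hμpos : ∀ x ∈ closure (Cyl R), 0 < μ x)
    (hu : UpTo 2 (Cyl R) u) (hw : UpTo 2 (Cyl R) w) (hus : AxialSupp u)
    (hdiv : ∀ x ∈ Cyl R, vdiv (fun y => (ε y : ℂ) • u y) x = 0)
    (hubc : ∀ x ∈ bCyl R, ∀ i, u x i = ncomp R x (u x) * (nuR R x i : ℂ))
    (hwbc : ∀ x ∈ bCyl R, ∀ i, w x i = ncomp R x (w x) * (nuR R x i : ℂ)) :
    ∫ x in Cyl R, (((μ x)⁻¹ : ℝ) : ℂ) * hinner (vcurl u x) (vcurl w x)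
      = (∫ x in Cyl R, ∑ j, hinner (pdV j (fun y => (Real.sqrt (ε y) : ℂ) • u y) x)
            (pdV j (fun y => (((Real.sqrt (ε y))⁻¹ * (μ y)⁻¹ : ℝ) : ℂ) • w y) x))
        - (∫ x in Cyl R, hinner (vcurl u x)
            ((ε x : ℂ) • cross (gradC (fun y => (ε y * μ y)⁻¹) x) (w x)))
        + (∫ x in Cyl R, (((μ x)⁻¹ : ℝ) : ℂ)
            * hinner (fun j => ∑ k, (Wm ε x j k : ℂ) * u x k) (w x))
        + surfInt R (fun x =>
            (((μ x)⁻¹ * R⁻¹ + (2 * ε x * μ x)⁻¹ * dnu R ε x : ℝ) : ℂ)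
              * hinner (u x) (w x)) := by
  obtain ⟨U, hU, hcl, hε, hμ, hu, hw, hεpos, hμpos⟩ :=
    exists_common_nhds hε hμ hεpos hμpos hu hw
  obtain ⟨T, -, hT⟩ := hus
  have hsub : Cyl R ⊆ U := subset_closure.trans hcl
  have dε : ∀ x ∈ U, DifferentiableAt ℝ ε x := fun x hx =>
    (hε.differentiableOn two_ne_zero).differentiableAt (hU.mem_nhds hx)
  have hu' := contDiffOn_pi.1 hu
  have hdiv' : ∀ x ∈ Cyl R, ∑ i, (pd i (fun y => (ε y : ℂ)) x * u x i
      + (ε x : ℂ) * pd i (fun y => u y i) x) = 0 := fun x hx => by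
    rw [← hdiv x hx]
    exact Finset.sum_congr rfl fun i _ => (pd_mul
      (differentiableAt_of_contDiffOn hU two_ne_zero (contDiffOn_ofReal hε) (hsub hx))
      (differentiableAt_of_contDiffOn hU two_ne_zero (hu' i) (hsub hx)) i).symm
  set F := flux (fun y => (ε y : ℂ)) (fun i y => u y i) (scaledConj ε μ w) with hF
  have hFs : ∀ i, ContDiffOn ℝ 1 (fun x => F x i) U :=
    contDiffOn_flux hU (contDiffOn_ofReal hε) hu' (contDiffOn_scaledConj hε hμ hw hεpos hμpos)
  have hF0 : ∀ x, T + 1 ≤ |x 2| → F x = 0 := fun x hx =>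
    flux_eq_zero_of_axialSupp (fun i y hy => congrFun (hT y hy) i) _ _ (by linarith)
  have hnε := fun x hx => (hεpos x hx).ne'
  have hnμ := fun x hx => (hμpos x hx).ne'
  have hμi : ContinuousOn (fun x => (((μ x)⁻¹ : ℝ) : ℂ)) U :=
    (contDiffOn_ofReal (hμ.inv hnμ)).continuousOn
  have hA : IntegrableOn (fun x => ∑ j, hinner (pdV j (fun y => (Real.sqrt (ε y) : ℂ) • u y) x)
      (pdV j (fun y => (((Real.sqrt (ε y))⁻¹ * (μ y)⁻¹ : ℝ) : ℂ) • w y) x)) (Cyl R) := by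
    refine integrableOn_Cyl (T := T + 1) hR (ContinuousOn.mono (continuousOn_finsetSum _ fun j _ =>
      continuousOn_hinner (continuousOn_pdV hU ?_ j) (continuousOn_pdV hU ?_ j)) hcl) ?_
    · exact ((contDiffOn_ofReal (hε.sqrt hnε)).smul hu).of_le one_le_two
    · exact ((contDiffOn_ofReal (((hε.sqrt hnε).inv fun x hx =>
        (Real.sqrt_pos.2 (hεpos x hx)).ne').mul (hμ.inv hnμ))).smul hw).of_le one_le_two
    · intro x hx
      refine Finset.sum_eq_zero fun j _ => ?_
      have h0 : pdV j (fun y => (Real.sqrt (ε y) : ℂ) • u y) x = 0 := by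
        ext i
        exact pd_eq_zero_of_axialSupp (T := T) (fun y hy => by simp [hT y hy]) j (by linarith)
      rw [h0, hinner_zero_left]
  have hB : IntegrableOn (fun x => hinner (vcurl u x)
      ((ε x : ℂ) • cross (gradC (fun y => (ε y * μ y)⁻¹) x) (w x))) (Cyl R) := by
    refine integrableOn_Cyl (T := T + 1) hR (ContinuousOn.mono (continuousOn_hinner
      (continuousOn_vcurl hU (hu.of_le one_le_two)) ((contDiffOn_ofReal hε).continuousOn.smul
        (continuousOn_cross (continuousOn_pi.2 fun j => ?_) hw.continuousOn))) hcl) fun x hx => ?_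
    · exact (contDiffOn_ofReal (contDiffOn_pdR hU ((hε.mul hμ).inv fun x hx =>
        mul_ne_zero (hnε x hx) (hnμ x hx)) j)).continuousOn
    · rw [vcurl_eq_zero_of_axialSupp hT (by linarith), hinner_zero_left]
  have hC : IntegrableOn (fun x => (((μ x)⁻¹ : ℝ) : ℂ)
      * hinner (fun j => ∑ k, (Wm ε x j k : ℂ) * u x k) (w x)) (Cyl R) := by
    refine integrableOn_Cyl (T := T) hR (ContinuousOn.mono (hμi.mul (continuousOn_hinner
      (continuousOn_pi.2 fun j => continuousOn_finsetSum _ fun k _ => ContinuousOn.mul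
        (Complex.continuous_ofReal.comp_continuousOn (continuousOn_Wm hU hε hεpos j k))
        (hu' k).continuousOn) hw.continuousOn)) hcl) fun x hx => ?_
    simp [hT x hx, hinner]
  have hD : IntegrableOn (vdiv F) (Cyl R) := by
    refine integrableOn_Cyl (T := T + 2) hR (ContinuousOn.mono (continuousOn_finsetSum _ fun j _ =>
      continuousOn_pd hU (hFs j) j) hcl) fun x hx => Finset.sum_eq_zero fun j _ => ?_
    exact pd_eq_zero_of_axialSupp (T := T + 1) (fun y hy => congrFun (hF0 y hy) j) j (by linarith)
  have hO := isOpen_Cyl R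
  have hpt := fun x (hx : x ∈ Cyl R) => hinner_vcurl_eq hO (hε.mono hsub) (hμ.mono hsub)
    (hu.mono hsub) (hw.mono hsub) (fun y hy => hεpos y (hsub hy)) (fun y hy => hμpos y (hsub hy))
    hdiv' hx
  refine (setIntegral_congr_fun hO.measurableSet hpt).trans
    ((integral_add' ((hA.sub hB).add hC) hD).trans ?_)
  rw [integral_add' (hA.sub hB) hC, integral_sub' hA hB, setIntegral_Cyl_vdiv hR hU hcl hFs hF0]
  congr 1
  have hbbc : ∀ x ∈ bCyl R, ∀ i, scaledConj ε μ w i x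
      = ncomp R x (fun k => scaledConj ε μ w k x) * (nuR R x i : ℂ) := fun x hx i => by
    have h := congrArg (starRingEnd ℂ) (hwbc x hx i)
    simp only [scaledConj, ncomp, map_mul, map_sum, Complex.conj_ofReal] at h ⊢
    rw [h, Finset.sum_mul, Finset.sum_mul, Finset.sum_mul]
    exact Finset.sum_congr rfl fun k _ => by ring
  refine integral_congr_ae (.of_forall fun t => intervalIntegral.integral_congr fun θ _ => ?_)
  dsimp only
  congr 1
  have hx : (![R * Real.cos θ, R * Real.sin θ, t] : V3) = polarPoint t (R, θ) := rfl
  have hxU : polarPoint t (R, θ) ∈ U := hcl (polarPoint_mem_closure hR ⟨hR.le, le_rfl⟩)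
  rw [hF, ncomp_flux_polarPoint hR hU hcl (contDiffOn_ofReal hε) hu' hdiv' hubc hbbc t θ hx, hx]
  generalize polarPoint t (R, θ) = x at hxU
  have hε0 : (ε x : ℂ) ≠ 0 := by exact_mod_cast hnε x hxU
  have hμ0 : (μ x : ℂ) ≠ 0 := by exact_mod_cast hnμ x hxU
  simp only [pd_ofReal (dε x hxU), scaledConj, hinner, dnu, ← mul_assoc, ← Finset.sum_mul]
  push_cast
  field_simp

end
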